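/- arXiv:2408.07017 — 6 statements merged into one kernel-verified Lean document; each statement's English description precedes it below -/
import Mathlib

section
/- Let h be a Hessenberg function on {1,…,n} and s = diag(1, 0, …, 0). Then for every i ∈ {1,…,n}, the ideal I_{s,h,i} equals the product ideal L_i · K_{h(i)}. -/
open MvPolynomial

noncomputable section

/-- The polynomial ring `R = ℂ[z_{ij} : 1 ≤ i,j ≤ n]` (indices 0-based). -/
abbrev R (n : ℕ) : Type := MvPolynomial (Fin n × Fin n) ℂ

/-- The ideal `L_i = ⟨z_{11}, …, z_{1i}⟩` (first row, first `i` variables; 0-based columns `j < i`).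
    `Lideal n 0 = ⟨0⟩`. -/
def Lideal (n : ℕ) [NeZero n] (i : ℕ) : Ideal (R n) :=
  Ideal.span { p | ∃ j : Fin n, (j : ℕ) < i ∧ p = X ((0 : Fin n), j) }

/-- The ideal `K_j`, generated by the `j × j` minors `p_B = det((z_{kℓ})_{k ∈ B, 1 ≤ ℓ ≤ j})`
    over all `j`-element subsets `B ⊆ {2, …, n}` (0-based: rows `B k ≠ 0`, columns `0,…,j-1`).
    For `j = n` (or `j > n`) there are no such subsets and the ideal is `⟨0⟩`. -/
def Kideal (n : ℕ) (j : ℕ) : Ideal (R n) :=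
  Ideal.span { p | ∃ (hj : j ≤ n) (B : Fin j → Fin n), StrictMono B ∧ (∀ k, (B k : ℕ) ≠ 0) ∧
    p = (Matrix.of fun k l : Fin j => (X (B k, Fin.castLE hj l) : R n)).det }

/-- A Hessenberg function (0-based): `h` is monotone with `h i ≥ i` for all `i`. -/
def IsHessenberg (n : ℕ) (h : Fin n → Fin n) : Prop := Monotone h ∧ ∀ i, i ≤ h i

/-- `i` is a corner of `h`, i.e. (1-based) `h(i) > h(i-1)` with the convention `h(0) = 0`;
    0-based, `i = 0` is always a corner. -/
def HessCorner (n : ℕ) (h : Fin n → Fin n) (i : Fin n) : Prop :=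
  (i : ℕ) = 0 ∨ h ⟨(i : ℕ) - 1, lt_of_le_of_lt (Nat.sub_le _ _) i.isLt⟩ < h i

/-- The `n × (i + h(i))` matrix with columns `x·v_1, …, x·v_i, v_1, …, v_{h(i)}`,
    where `v_j` is the `j`-th column of the generic matrix `Z`. Here (0-based) the paper's
    `i` is `a+1` and the paper's `h(i)` is `(h a) + 1`. -/
def hessMat (n : ℕ) (x : Matrix (Fin n) (Fin n) ℂ) (h : Fin n → Fin n) (a : Fin n) :
    Matrix (Fin n) (Fin ((a : ℕ) + 1) ⊕ Fin (((h a) : ℕ) + 1)) (R n) :=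
  Matrix.of fun r c => Sum.elim
    (fun c' => ∑ k : Fin n, MvPolynomial.C (x r k) * X (k, Fin.castLE a.isLt c'))
    (fun c' => X (r, Fin.castLE (h a).isLt c')) c

/-- The ideal `I_{x,h,i}` generated by all `(h(i)+1) × (h(i)+1)` minors of `hessMat`
    (paper's `h(i)+1` is `(h a) + 2` 0-based). -/
def hessIdealAt (n : ℕ) (x : Matrix (Fin n) (Fin n) ℂ) (h : Fin n → Fin n) (a : Fin n) :
    Ideal (R n) :=
  Ideal.span { p | ∃ (f : Fin (((h a) : ℕ) + 2) → Fin n)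
    (g : Fin (((h a) : ℕ) + 2) → Fin ((a : ℕ) + 1) ⊕ Fin (((h a) : ℕ) + 1)),
    p = ((hessMat n x h a).submatrix f g).det }

/-- The ideal `I_{x,h} = Σ_{i=1}^n I_{x,h,i}`. -/
def hessIdeal (n : ℕ) (x : Matrix (Fin n) (Fin n) ℂ) (h : Fin n → Fin n) : Ideal (R n) :=
  ∑ a : Fin n, hessIdealAt n x h a

/-- The minimal semisimple element `s = diag(1, 0, …, 0)`. -/
def sMat (n : ℕ) [NeZero n] : Matrix (Fin n) (Fin n) ℂ :=
  Matrix.diagonal (fun i => if i = 0 then 1 else 0)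

/-- The rank `r_{pq}(w)` of the top-left `(p+1) × (q+1)` (0-based) submatrix of the
    permutation matrix of `w`. -/
def rankpq (n : ℕ) (w : Equiv.Perm (Fin n)) (p q : Fin n) : ℕ :=
  (Finset.univ.filter fun j : Fin n => j ≤ q ∧ w j ≤ p).card

/-- The Schubert determinantal ideal `I_w`: generated, over all `p, q`, by the minors of size
    `1 + r_{pq}(w)` of the top-left `(p+1) × (q+1)` (0-based) submatrix of the generic matrix. -/
def schubertIdeal (n : ℕ) (w : Equiv.Perm (Fin n)) : Ideal (R n) :=
  Ideal.span { m | ∃ (p q : Fin n) (f g : Fin (rankpq n w p q + 1) → Fin n),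
    (∀ k, f k ≤ p) ∧ (∀ k, g k ≤ q) ∧
    m = (Matrix.of fun k l => (X (f k, g l) : R n)).det }

/-- The generic matrix `Z`. -/
def genZ (n : ℕ) : Matrix (Fin n) (Fin n) (R n) :=
  Matrix.of fun k l => X (k, l)

/-- Each column `s·v_c` of the Hessenberg matrix of `s = diag(1, 0, …, 0)` is supported on the
first row. -/
lemma hessMat_sMat_inl (n : ℕ) [NeZero n] (h : Fin n → Fin n) (a r : Fin n)
    (c : Fin ((a : ℕ) + 1)) :
    hessMat n (sMat n) h a r (Sum.inl c) =
      if r = 0 then X ((0 : Fin n), Fin.castLE a.isLt c) else 0 := by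
  simp only [hessMat, sMat, Matrix.of_apply, Sum.elim_inl]
  rw [Finset.sum_eq_single r]
  · by_cases hr : r = 0 <;> simp [hr]
  · intro k _ hk
    simp [Matrix.diagonal_apply_ne _ hk.symm]
  · simp

/-- A maximal minor of the first `m` columns avoiding the first row lies in `K_m`, whatever the
order of its rows and columns. -/
lemma det_mem_Kideal (n m : ℕ) (hm : m ≤ n) (B : Fin m → Fin n) (hB : ∀ k, (B k : ℕ) ≠ 0)
    (c : Fin m → Fin m) :
    (Matrix.of fun k l : Fin m => (X (B k, Fin.castLE hm (c l)) : R n)).det ∈ Kideal n m := by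
  by_cases hBi : Function.Injective B
  swap
  · obtain ⟨k, l, hkl, hne⟩ := Function.not_injective_iff.mp hBi
    rw [Matrix.det_zero_of_row_eq hne (by ext; simp [hkl])]
    exact zero_mem _
  by_cases hc : Function.Injective c
  swap
  · obtain ⟨k, l, hkl, hne⟩ := Function.not_injective_iff.mp hc
    rw [Matrix.det_zero_of_column_eq hne (by simp [hkl])]
    exact zero_mem _
  let σ : Equiv.Perm (Fin m) := Equiv.ofBijective c (Finite.injective_iff_bijective.mp hc)
  let τ : Equiv.Perm (Fin m) := Tuple.sort B
  have hmono : StrictMono (B ∘ τ) :=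
    (Tuple.monotone_sort B).strictMono_of_injective (hBi.comp τ.injective)
  let N : Matrix (Fin m) (Fin m) (R n) :=
    Matrix.of fun k l => X ((B ∘ τ) k, Fin.castLE hm l)
  have hN : N.det ∈ Kideal n m :=
    Ideal.subset_span ⟨hm, B ∘ τ, hmono, fun k => hB (τ k), rfl⟩
  have hsub : (Matrix.of fun k l : Fin m => (X (B k, Fin.castLE hm (c l)) : R n)) =
      (N.submatrix τ.symm id).submatrix id σ := by
    ext k l
    simp [N, σ]
  rw [hsub, Matrix.det_permute', Matrix.det_permute]
  exact Ideal.mul_mem_left _ _ (Ideal.mul_mem_left _ _ hN)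

/-- A minor of the Hessenberg matrix of `s` avoiding the first row lies in `K_{h(i)}`. -/
lemma det_submatrix_hessMat_mem_Kideal (n : ℕ) [NeZero n] (h : Fin n → Fin n) (a : Fin n)
    (B : Fin ((h a : ℕ) + 1) → Fin n) (hB : ∀ k, B k ≠ 0)
    (g : Fin ((h a : ℕ) + 1) → Fin ((a : ℕ) + 1) ⊕ Fin ((h a : ℕ) + 1)) :
    ((hessMat n (sMat n) h a).submatrix B g).det ∈ Kideal n ((h a : ℕ) + 1) := by
  by_cases hg : ∃ k c, g k = Sum.inl c
  · obtain ⟨k, c, hk⟩ := hg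
    rw [Matrix.det_eq_zero_of_column_eq_zero k]
    · exact zero_mem _
    · intro r
      simp [hk, hessMat_sMat_inl, hB r]
  · have hright : ∀ k, ∃ c, g k = Sum.inr c := fun k => by
      rcases hgk : g k with c | c
      · exact absurd ⟨k, c, hgk⟩ hg
      · exact ⟨c, rfl⟩
    choose c hc using hright
    convert det_mem_Kideal n _ (h a).isLt B (fun k => Fin.val_ne_zero_iff.mpr (hB k)) c using 2
    ext k l
    simp [hc, hessMat]

/-- Remark 3.1: for `s = diag(1,0,…,0)` and every `i`,
`I_{s,h,i} = L_i · K_{h(i)}` (0-based: the paper's `i` is `i+1` and the paper's `h(i)` is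
`(h i) + 1`). -/
theorem stmt10 (n : ℕ) [NeZero n] (h : Fin n → Fin n) (hh : IsHessenberg n h) (i : Fin n) :
    hessIdealAt n (sMat n) h i = Lideal n ((i : ℕ) + 1) * Kideal n (((h i) : ℕ) + 1) := by
  apply le_antisymm
  · refine Ideal.span_le.mpr ?_
    rintro _ ⟨f, g, rfl⟩
    rw [SetLike.mem_coe]
    by_cases hf : Function.Injective f
    swap
    · obtain ⟨k, l, hkl, hne⟩ := Function.not_injective_iff.mp hf
      rw [Matrix.det_zero_of_row_eq hne (by ext; simp [hkl])]
      exact zero_mem _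
    by_cases hg : ∃ k c, g k = Sum.inl c
    · obtain ⟨k, c, hk⟩ := hg
      rw [Matrix.det_succ_column _ k]
      refine sum_mem fun r _ => ?_
      rw [Matrix.submatrix_apply, hk, hessMat_sMat_inl]
      split_ifs with hr
      · rw [mul_assoc]
        refine Ideal.mul_mem_left _ _ (Ideal.mul_mem_mul
          (Ideal.subset_span ⟨Fin.castLE i.isLt c, c.isLt, rfl⟩) ?_)
        rw [Matrix.submatrix_submatrix]
        exact det_submatrix_hessMat_mem_Kideal n h i _
          (fun k hk => Fin.succAbove_ne r k (hf (hk.trans hr.symm))) _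
      · simp
    · have hright : ∀ k, ∃ c, g k = Sum.inr c := fun k => by
        rcases hgk : g k with c | c
        · exact absurd ⟨k, c, hgk⟩ hg
        · exact ⟨c, rfl⟩
      choose c hc using hright
      obtain ⟨k, l, hne, hkl⟩ := Fintype.exists_ne_map_eq_of_card_lt c (by simp)
      rw [Matrix.det_zero_of_column_eq hne (by simp [hc, hkl])]
      exact zero_mem _
  · rw [Lideal, Kideal, Ideal.span_mul_span', Ideal.span_le]
    rintro _ ⟨_, ⟨j, hj, rfl⟩, _, ⟨hm, B, -, hB, rfl⟩, rfl⟩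
    refine Ideal.subset_span ⟨Fin.cons 0 B, Fin.cons (Sum.inl ⟨j, hj⟩) Sum.inr, ?_⟩
    rw [Matrix.det_succ_column_zero ((hessMat n (sMat n) h i).submatrix _ _),
      Finset.sum_eq_single 0]
    · simp only [Matrix.submatrix_apply, Fin.cons_zero, hessMat_sMat_inl, if_true,
        Matrix.submatrix_submatrix, Fin.val_zero, pow_zero, one_mul]
      congr 2
    · intro r _ hr
      obtain ⟨k, rfl⟩ := Fin.exists_succ_eq.mpr hr
      simp [hessMat_sMat_inl, Fin.val_ne_zero_iff.mp (hB k)]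
    · simp
end
end

section
/- For all integers i, j with 1 ≤ i ≤ j ≤ n, the Krull dimension of the quotient ring R / (L_{i−1} + K_j) equals n(n+1)/2 + (n−1)(n−2)/2 + (j − i). -/
open MvPolynomial

noncomputable section

section KrullDimension

variable {A : Type*} [CommRing A]

/-- If every prime containing `I` has height at least `t`, then `dim A ⧸ I ≤ dim A - t`. -/
lemma ringKrullDim_quotient_le_sub (I : Ideal A) (d t : ℕ) (hd : ringKrullDim A ≤ d)
    (h : ∀ P : Ideal A, P.IsPrime → I ≤ P → (t : ℕ∞) ≤ P.height) :
    ringKrullDim (A ⧸ I) ≤ ((d - t : ℕ) : WithBot ℕ∞) := by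
  rw [ringKrullDim_quotient]
  refine iSup_le fun p => ?_
  have hp := h p.head.1.asIdeal p.head.1.isPrime p.head.2
  rw [PrimeSpectrum.height_eq_orderHeight] at hp
  obtain ⟨q, hq, hqt⟩ := Order.exists_series_of_le_height p.head.1 hp
  have hlen := (Order.LTSeries.length_le_krullDim
    (q.smash (p.map Subtype.val fun _ _ => id) hq)).trans hd
  change ((q.length + p.length : ℕ) : WithBot ℕ∞) ≤ d at hlen
  rw [hqt] at hlen
  norm_cast at hlen ⊢
  lia

/-- If `I` lies in every prime between `s` and a prime `M`, then
`height M - #s ≤ dim A ⧸ I`. -/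
lemma sub_card_le_ringKrullDim_quotient [IsNoetherianRing A] (I M : Ideal A) [M.IsPrime]
    (s : Finset A) (d : ℕ) (hd : (d : ℕ∞) ≤ M.height) (hs : (s : Set A) ⊆ M)
    (h : ∀ Q : Ideal A, Q.IsPrime → (s : Set A) ⊆ Q → Q ≤ M → I ≤ Q) :
    ((d - s.card : ℕ) : WithBot ℕ∞) ≤ ringKrullDim (A ⧸ I) := by
  have hsM : Ideal.span (s : Set A) ≤ M := Ideal.span_le.mpr hs
  have hM' : (M.map (Ideal.Quotient.mk (Ideal.span (s : Set A)))).IsPrime :=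
    Ideal.isPrime_map_quotientMk_of_isPrime hsM
  have hle := hd.trans (Ideal.height_le_height_add_encard_of_subset (s : Set A) hs)
  rw [Set.encard_coe_eq_coe_finsetCard] at hle
  have hle' : ((d - s.card : ℕ) : ℕ∞) ≤
      (M.map (Ideal.Quotient.mk (Ideal.span (s : Set A)))).height := by
    rw [ENat.natCast_sub]
    exact tsub_le_iff_right.mpr hle
  rw [PrimeSpectrum.height_eq_orderHeight ⟨_, hM'⟩] at hle'
  obtain ⟨q, hq, hqt⟩ := Order.exists_series_of_le_height _ hle'
  let mk := Ideal.Quotient.mk (Ideal.span (s : Set A))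
  have hmk : StrictMono (PrimeSpectrum.comap mk) := fun x y hxy =>
    lt_of_le_of_ne (Ideal.comap_mono hxy.le) fun heq => hxy.ne
      (PrimeSpectrum.comap_injective_of_surjective mk Ideal.Quotient.mk_surjective heq)
  have hI : I ≤ (PrimeSpectrum.comap mk q.head).asIdeal := by
    refine h _ (PrimeSpectrum.isPrime _) (fun x hx => ?_) ?_
    · have h0 : mk x = 0 := Ideal.Quotient.eq_zero_iff_mem.mpr (Ideal.subset_span hx)
      change mk x ∈ q.head.asIdeal
      rw [h0]
      exact zero_mem _
    · have hle : q.head ≤ ⟨_, hM'⟩ := hq ▸ LTSeries.head_le_last q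
      refine (Ideal.comap_mono (f := mk) hle).trans ?_
      rw [Ideal.comap_map_quotientMk, sup_eq_right.mpr hsM]
  let p : LTSeries (PrimeSpectrum.zeroLocus (I : Set A)) :=
    { length := q.length
      toFun := fun i => ⟨PrimeSpectrum.comap mk (q i),
        hI.trans (hmk.monotone (LTSeries.head_le q i))⟩
      step := fun i => hmk (q.step i) }
  rw [ringKrullDim_quotient, ← hqt]
  exact Order.LTSeries.length_le_krullDim p

end KrullDimension

section Height

variable {σ : Type*} {k : Type*} [Field k]

open scoped Classical in
/-- The substitution `X s ↦ c s / D` for `s ∈ T`, fixing the other variables. -/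
def solveHom (D : MvPolynomial σ k) (c : σ → MvPolynomial σ k) (T : Finset σ) :
    MvPolynomial σ k →ₐ[k] Localization.Away D :=
  aeval fun s => if s ∈ T then IsLocalization.mk' (Localization.Away D) (c s)
      (⟨D, 1, pow_one D⟩ : Submonoid.powers D)
    else algebraMap (MvPolynomial σ k) _ (X s)

lemma ker_solveHom_le (D : MvPolynomial σ k) (c : σ → MvPolynomial σ k) (T : Finset σ)
    (Q : Ideal (MvPolynomial σ k)) [Q.IsPrime] (hD : D ∉ Q)
    (hc : ∀ s ∈ T, D * X s - c s ∈ Q) : RingHom.ker (solveHom D c T) ≤ Q := by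
  classical
  let π : MvPolynomial σ k →+* Q.ResidueField := algebraMap _ _
  have hπ (x) : π x = 0 ↔ x ∈ Q := Ideal.algebraMap_residueField_eq_zero
  have hDu : IsUnit (π D) := IsUnit.mk0 _ (by rwa [Ne, hπ])
  let l : Localization.Away D →+* Q.ResidueField := IsLocalization.Away.lift D hDu
  have hl (x) : l (algebraMap _ _ x) = π x := IsLocalization.Away.lift_eq D hDu x
  have key : l.comp (solveHom D c T : MvPolynomial σ k →+* _) = π := by
    apply MvPolynomial.ringHom_ext
    · intro a
      have : (solveHom D c T) (C a) = algebraMap (MvPolynomial σ k) _ (C a) := by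
        rw [solveHom, aeval_C, IsScalarTower.algebraMap_apply k (MvPolynomial σ k)]
        rfl
      simp [this, hl]
    · intro s
      by_cases hs : s ∈ T
      · have h0 := (hπ _).mpr (hc s hs)
        rw [map_sub, map_mul, sub_eq_zero] at h0
        apply hDu.mul_left_cancel
        rw [h0, ← hl D, ← hl (c s), RingHom.comp_apply, ← map_mul]
        congr 1
        simp only [solveHom, RingHom.coe_coe, aeval_X, hs, if_true]
        exact IsLocalization.mk'_spec' (Localization.Away D) (c s)
          (⟨D, 1, pow_one D⟩ : Submonoid.powers D)
      · simp [solveHom, hs, hl]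
  intro f hf
  rw [← hπ, ← key, RingHom.comp_apply]
  rw [RingHom.mem_ker] at hf
  simp [hf]

lemma algHom_congr_of_mem_supported {B : Type*} [CommSemiring B] [Algebra k B] {U : Set σ}
    {p : MvPolynomial σ k} (hp : p ∈ supported k U) (φ ψ : MvPolynomial σ k →ₐ[k] B)
    (h : ∀ s ∈ U, φ (X s) = ψ (X s)) : φ p = ψ p := by
  have : supported k U ≤ AlgHom.equalizer φ ψ := by
    rw [supported_eq_adjoin_X, Algebra.adjoin_le_iff]
    rintro _ ⟨s, hs, rfl⟩
    exact h s hs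
  exact this hp

/-- A prime containing `D * X s - c s` for `s ∈ S`, but not `D`, has height at least `#S`,
provided `D` and the `c s` do not involve the variables in `S`. -/
lemma card_le_height (D : MvPolynomial σ k) (c : σ → MvPolynomial σ k) (S : Finset σ)
    (hDS : D ∈ supported k ((S : Set σ)ᶜ)) (hcS : ∀ s ∈ S, c s ∈ supported k ((S : Set σ)ᶜ))
    (P : Ideal (MvPolynomial σ k)) [P.IsPrime] (hD : D ∉ P)
    (hc : ∀ s ∈ S, D * X s - c s ∈ P) : (S.card : ℕ∞) ≤ P.height := by
  classical
  have hD0 : D ≠ 0 := by rintro rfl; exact hD P.zero_mem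
  have hpow : Submonoid.powers D ≤ nonZeroDivisors (MvPolynomial σ k) :=
    powers_le_nonZeroDivisors_of_noZeroDivisors hD0
  have hdom : IsDomain (Localization.Away D) := IsLocalization.isDomain_localization hpow
  have hinj : Function.Injective (algebraMap (MvPolynomial σ k) (Localization.Away D)) :=
    IsLocalization.injective _ hpow
  have hprime (T : Finset σ) : (RingHom.ker (solveHom D c T)).IsPrime := RingHom.ker_isPrime _
  have hfix (T : Finset σ) (hT : T ⊆ S) (p) (hp : p ∈ supported k ((S : Set σ)ᶜ)) :
      solveHom D c T p = algebraMap _ _ p := by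
    refine algHom_congr_of_mem_supported hp _
      (IsScalarTower.toAlgHom k (MvPolynomial σ k) (Localization.Away D)) fun s hs => ?_
    have : s ∉ T := fun h => hs (hT h)
    simp [solveHom, this]
  have hX (T : Finset σ) (s) (hs : s ∈ T) : algebraMap _ _ D * solveHom D c T (X s) =
      algebraMap _ (Localization.Away D) (c s) := by
    simp only [solveHom, aeval_X, hs, if_true]
    exact IsLocalization.mk'_spec' (Localization.Away D) (c s)
          (⟨D, 1, pow_one D⟩ : Submonoid.powers D)
  have hmem (T : Finset σ) (hT : T ⊆ S) (s) (hs : s ∈ T) :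
      D * X s - c s ∈ RingHom.ker (solveHom D c T) := by
    rw [RingHom.mem_ker, map_sub, map_mul, hfix T hT D hDS, hfix T hT _ (hcS s (hT hs)),
      hX T s hs, sub_self]
  have hDT (T : Finset σ) (hT : T ⊆ S) : D ∉ RingHom.ker (solveHom D c T) := by
    rw [RingHom.mem_ker, hfix T hT D hDS, map_eq_zero_iff _ hinj]
    exact hD0
  have hchain (T : Finset σ) (hT : T ⊆ S) :
      (T.card : ℕ∞) ≤ (RingHom.ker (solveHom D c T)).height := by
    induction T using Finset.induction_on with
    | empty => simp
    | insert s T hs ih =>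
      have hTS : T ⊆ S := (Finset.subset_insert s T).trans hT
      have hsS : s ∈ S := hT (Finset.mem_insert_self s T)
      have hle : RingHom.ker (solveHom D c T) ≤ RingHom.ker (solveHom D c (insert s T)) :=
        ker_solveHom_le D c T _ (hDT _ hT) fun t ht =>
          hmem _ hT t (Finset.mem_insert_of_mem ht)
      have hlt : RingHom.ker (solveHom D c T) < RingHom.ker (solveHom D c (insert s T)) := by
        refine lt_of_le_of_ne hle fun heq => ?_
        have h0 := hmem _ hT s (Finset.mem_insert_self s T)
        rw [← heq, RingHom.mem_ker, map_sub, map_mul, hfix T hTS D hDS,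
          hfix T hTS _ (hcS s hsS)] at h0
        have hXs : solveHom D c T (X s) = algebraMap (MvPolynomial σ k) _ (X s) := by
          simp [solveHom, hs]
        rw [hXs, ← map_mul, ← map_sub, map_eq_zero_iff _ hinj, sub_eq_zero] at h0
        have hev (b : MvPolynomial σ k) : D * b = c s := by
          have h1 := congrArg (aeval (R := k) (Function.update X s b)) h0
          have hid (p) (hp : p ∈ supported k ((S : Set σ)ᶜ)) :
              aeval (R := k) (Function.update X s b) p = p := by
            refine algHom_congr_of_mem_supported hp _ (AlgHom.id k _) fun t ht => ?_
            have : t ≠ s := by rintro rfl; exact ht hsS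
            simp [this]
          rwa [map_mul, hid D hDS, hid _ (hcS s hsS), aeval_X, Function.update_self] at h1
        have h1 := (hev 0).trans (hev 1).symm
        simp [hD0.symm] at h1
      rw [Finset.card_insert_of_notMem hs, Nat.cast_add, Nat.cast_one]
      exact (add_le_add_left (ih hTS) 1).trans (Ideal.height_add_one_le_of_lt_of_isPrime hlt)
  exact (hchain S subset_rfl).trans (Ideal.height_mono (ker_solveHom_le D c S P hD hc))

end Height

section Determinants

variable {D : Type*} [CommRing D] {ι : Type*} {k : ℕ}

/-- Rank bound from bordered minors: if a `k × k` minor is nonzero and all its borderings by the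
rows of `B` vanish, then the `(k + 1) × (k + 1)` minor with rows `B` vanishes. -/
lemma det_eq_zero_of_bordered_eq_zero [IsDomain D] (Z : ι → Fin (k + 1) → D) (f : Fin k → ι)
    (hf : (Matrix.of fun p q : Fin k => Z (f p) q.castSucc).det ≠ 0) (B : Fin (k + 1) → ι)
    (hB : ∀ p, (Matrix.of fun p' q => Z (Fin.snoc (α := fun _ => ι) f (B p) p') q).det = 0) :
    (Matrix.of fun p q => Z (B p) q).det = 0 := by
  rw [← Matrix.exists_mulVec_eq_zero_iff]
  refine ⟨fun l => (-1) ^ (k + (l : ℕ)) *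
    (Matrix.of fun p q : Fin k => Z (f p) (l.succAbove q)).det, fun h => hf ?_, ?_⟩
  · simpa [Fin.succAbove_last] using congrFun h (Fin.last k)
  · ext p
    rw [Pi.zero_apply, ← hB p, Matrix.det_succ_row _ (Fin.last k), Matrix.mulVec, dotProduct]
    refine Finset.sum_congr rfl fun l _ => ?_
    have : (Matrix.of fun p' q => Z (Fin.snoc (α := fun _ => ι) f (B p) p') q).submatrix
        (Fin.last k).succAbove l.succAbove =
        Matrix.of fun p q : Fin k => Z (f p) (l.succAbove q) := by
      ext; simp [Fin.succAbove_last]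
    rw [this]
    simp
    ring

end Determinants

variable {n : ℕ}

/-- The minor of the generic matrix with rows `B` and the first `j` columns. -/
def firstMinor {j : ℕ} (hj : j ≤ n) (B : Fin j → Fin n) : R n :=
  (Matrix.of fun k l : Fin j => (X (B k, Fin.castLE hj l) : R n)).det

lemma firstMinor_mem_Kideal {j : ℕ} (hj : j ≤ n) (B : Fin j → Fin n)
    (hB : ∀ k, (B k : ℕ) ≠ 0) : firstMinor hj B ∈ Kideal n j := by
  by_cases hinj : Function.Injective B
  · have hmono : StrictMono (B ∘ Tuple.sort B) :=
      (Tuple.monotone_sort B).strictMono_of_injective (hinj.comp (Tuple.sort B).injective)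
    have hmem : firstMinor hj (B ∘ Tuple.sort B) ∈ Kideal n j :=
      Ideal.subset_span ⟨hj, _, hmono, fun k => hB _, rfl⟩
    have : firstMinor hj (B ∘ Tuple.sort B) =
        ((Equiv.Perm.sign (Tuple.sort B) : ℤ) : R n) * firstMinor hj B :=
      Matrix.det_permute (Tuple.sort B)
        (Matrix.of fun k l : Fin j => (X (B k, Fin.castLE hj l) : R n))
    rw [this] at hmem
    refine (Ideal.unit_mul_mem_iff_mem _ ?_).mp hmem
    exact ((Equiv.Perm.sign (Tuple.sort B)).isUnit.map (Int.castRingHom (R n)))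
  · simp only [Function.Injective, not_forall] at hinj
    obtain ⟨a, b, hab, hne⟩ := hinj
    have : firstMinor hj B = 0 := Matrix.det_zero_of_row_eq hne (by ext l; simp [hab])
    rw [this]
    exact zero_mem _

/-- The negative of the expansion of the minor with rows `f, r` along the row `r`, with the last
term omitted. -/
def borderTail {k : ℕ} (hk : k + 1 ≤ n) (f : Fin k → Fin n) (r : Fin n) : R n :=
  -∑ l : Fin k, (-1) ^ (k + (l : ℕ)) * X (r, Fin.castLE hk l.castSucc) *
    (Matrix.of fun p q : Fin k => (X (f p, Fin.castLE hk (l.castSucc.succAbove q)) : R n)).det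

lemma firstMinor_snoc {k : ℕ} (hk : k + 1 ≤ n) (f : Fin k → Fin n) (r : Fin n) :
    firstMinor (Nat.le_of_succ_le hk) f * X (r, ⟨k, hk⟩) - borderTail hk f r =
      firstMinor hk (Fin.snoc (α := fun _ => Fin n) f r) := by
  have hsub (l : Fin (k + 1)) : (Matrix.of fun p q : Fin (k + 1) =>
      (X (Fin.snoc (α := fun _ => Fin n) f r p, Fin.castLE hk q) : R n)).submatrix
        Fin.castSucc l.succAbove =
      Matrix.of fun p q : Fin k => (X (f p, Fin.castLE hk (l.succAbove q)) : R n) := by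
    ext; simp
  have hlast : Fin.castLE hk (Fin.last k) = ⟨k, hk⟩ := rfl
  have hcols (q : Fin k) : Fin.castLE hk q.castSucc = Fin.castLE (Nat.le_of_succ_le hk) q := rfl
  have hsub' : (Matrix.of fun p q : Fin (k + 1) =>
      (X (Fin.snoc (α := fun _ => Fin n) f r p, Fin.castLE hk q) : R n)).submatrix
        Fin.castSucc Fin.castSucc =
      Matrix.of fun p q : Fin k => (X (f p, Fin.castLE (Nat.le_of_succ_le hk) q) : R n) := by
    simpa only [Fin.succAbove_last, hcols] using hsub (Fin.last k)
  have hsign : ((-1) ^ (k + k) : R n) = 1 := by rw [← two_mul, pow_mul]; simp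
  rw [firstMinor, firstMinor, Matrix.det_succ_row _ (Fin.last k), Fin.sum_univ_castSucc]
  simp only [Fin.succAbove_last, hsub, hsub', Matrix.of_apply, Fin.snoc_last, Fin.val_last,
    Fin.val_castSucc, hlast, hcols, hsign, one_mul, borderTail, sub_neg_eq_add]
  rw [add_comm, mul_comm (X _)]

lemma det_mem_of_forall_mem {S : Type*} [CommRing S] {B : Type*} [CommRing B] [Algebra B S]
    (U : Subalgebra B S) {m : ℕ} (M : Matrix (Fin m) (Fin m) S) (h : ∀ p q, M p q ∈ U) :
    M.det ∈ U := by
  rw [Matrix.det_apply]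
  refine U.sum_mem fun σ _ => ?_
  rw [Units.smul_def]
  exact U.zsmul_mem (U.prod_mem fun p _ => h _ _) _

/-- The variables `z_{1l}`, `l ≤ a`, together with the entries of column `k + 1` outside the first
row and the rows `f`. -/
def pivotVars [NeZero n] {k : ℕ} (hk : k + 1 ≤ n) (f : Fin k → Fin n) (a : ℕ) :
    Finset (Fin n × Fin n) :=
  ({0} : Finset (Fin n)) ×ˢ (Finset.univ.filter fun l : Fin n => (l : ℕ) < a) ∪
    (insert 0 (Finset.univ.image f))ᶜ ×ˢ {⟨k, hk⟩}

lemma mem_pivotVars [NeZero n] {k : ℕ} (hk : k + 1 ≤ n) (f : Fin k → Fin n) (a : ℕ)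
    (s : Fin n × Fin n) : s ∈ pivotVars hk f a ↔
      (s.1 = 0 ∧ (s.2 : ℕ) < a) ∨ ((s.1 ≠ 0 ∧ ∀ p, f p ≠ s.1) ∧ s.2 = ⟨k, hk⟩) := by
  obtain ⟨r, c⟩ := s
  rw [pivotVars, Finset.mem_union, Finset.mem_product, Finset.mem_product]
  simp

lemma card_pivotVars [NeZero n] {k : ℕ} (hk : k + 1 ≤ n) (f : Fin k → Fin n) (a : ℕ)
    (hf : Function.Injective f) (hf0 : ∀ p, f p ≠ 0) (ha : a ≤ n) :
    (pivotVars hk f a).card = a + (n - (k + 1)) := by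
  rw [pivotVars, Finset.card_union_of_disjoint, Finset.card_product, Finset.card_product,
    Finset.card_compl, Finset.card_insert_of_notMem (by simpa using hf0),
    Finset.card_image_of_injective _ hf, Fin.card_filter_val_lt]
  · simp [ha]
  · rw [Finset.disjoint_left]
    rintro ⟨x, y⟩ h1 h2
    simp only [Finset.mem_product, Finset.mem_singleton, Finset.mem_compl,
      Finset.mem_insert, not_or] at h1 h2
    exact h2.1.1 h1.1

/-- The constant terms `c s` for which `Δ * X s - c s` cut out the determinantal locus. -/
def pivotConst [NeZero n] {k : ℕ} (hk : k + 1 ≤ n) (f : Fin k → Fin n)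
    (s : Fin n × Fin n) : R n :=
  if s.1 = 0 then 0 else borderTail hk f s.1

lemma firstMinor_mem_supported [NeZero n] {k : ℕ} (hk : k + 1 ≤ n) (f : Fin k → Fin n) (a : ℕ)
    (hf0 : ∀ p, f p ≠ 0) :
    firstMinor (Nat.le_of_succ_le hk) f ∈
      supported ℂ ((pivotVars hk f a : Set (Fin n × Fin n))ᶜ) := by
  refine det_mem_of_forall_mem _ _ fun p q => ?_
  rw [Matrix.of_apply, X_mem_supported, Set.mem_compl_iff, Finset.mem_coe, mem_pivotVars]
  simp [hf0]

lemma pivotConst_mem_supported [NeZero n] {k : ℕ} (hk : k + 1 ≤ n) (f : Fin k → Fin n) (a : ℕ)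
    (hf0 : ∀ p, f p ≠ 0) (s : Fin n × Fin n) :
    pivotConst hk f s ∈ supported ℂ ((pivotVars hk f a : Set (Fin n × Fin n))ᶜ) := by
  rw [pivotConst]
  split_ifs with hs
  · exact zero_mem _
  · refine neg_mem (sum_mem fun l _ => mul_mem (mul_mem ?_ ?_) ?_)
    · exact pow_mem (neg_mem (one_mem _)) _
    · rw [X_mem_supported, Set.mem_compl_iff, Finset.mem_coe, mem_pivotVars]
      have := l.isLt.ne
      simp [hs, Fin.ext_iff, this]
    · refine det_mem_of_forall_mem _ _ fun p q => ?_
      rw [Matrix.of_apply, X_mem_supported, Set.mem_compl_iff, Finset.mem_coe, mem_pivotVars]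
      simp [hf0]

lemma le_height_of_le [NeZero n] (a j : ℕ) (ha : a ≤ n) (hj : j ≤ n) (P : Ideal (R n))
    [P.IsPrime] (hP : Lideal n a + Kideal n j ≤ P) : ((a + (n - j) : ℕ) : ℕ∞) ≤ P.height := by
  classical
  have hL : Lideal n a ≤ P := le_sup_left.trans hP
  have hex : ∃ m, Kideal n m ≤ P := ⟨j, le_sup_right.trans hP⟩
  have hmin : Nat.find hex ≤ j := Nat.find_min' hex (le_sup_right.trans hP)
  have hspec := Nat.find_spec hex
  rcases hm : Nat.find hex with _ | k
  · rw [hm] at hspec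
    refine absurd (hspec (Ideal.subset_span ⟨Nat.zero_le n, Fin.elim0, fun x => x.elim0,
      fun x => x.elim0, ?_⟩)) ((Ideal.ne_top_iff_one P).mp Ideal.IsPrime.ne_top')
    simp
  · rw [hm] at hspec hmin
    have hk : k + 1 ≤ n := hmin.trans hj
    have hnot : ¬ Kideal n k ≤ P := Nat.find_min hex (by lia)
    rw [Kideal, Ideal.span_le, Set.not_subset] at hnot
    obtain ⟨_, ⟨hkn, f, hmono, hf, rfl⟩, hD⟩ := hnot
    have hf0 : ∀ p, f p ≠ 0 := fun p h => hf p (by simp [h])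
    have hcard := card_le_height (firstMinor hkn f) (pivotConst hk f) (pivotVars hk f a)
      (firstMinor_mem_supported hk f a hf0) (fun s _ => pivotConst_mem_supported hk f a hf0 s)
      P hD fun s hs => by
        rw [mem_pivotVars] at hs
        rcases hs with ⟨h0, hlt⟩ | ⟨⟨h0, -⟩, h2⟩
        · rw [pivotConst, if_pos h0, sub_zero]
          exact P.mul_mem_left _ (hL (Ideal.subset_span ⟨s.2, hlt, by rw [← h0]⟩))
        · rw [pivotConst, if_neg h0]
          obtain ⟨r, c⟩ := s
          obtain rfl : c = ⟨k, hk⟩ := h2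
          rw [firstMinor_snoc]
          refine hspec (firstMinor_mem_Kideal hk _ fun p => ?_)
          refine Fin.lastCases ?_ (fun p => ?_) p
          · rw [Fin.snoc_last]
            exact fun h => h0 (by simpa using h)
          · simpa using hf p
    rw [card_pivotVars hk f a hmono.injective hf0 ha] at hcard
    refine le_trans ?_ hcard
    norm_cast
    lia

lemma le_of_pivot_mem [NeZero n] (a : ℕ) {k : ℕ} (hk : k + 1 ≤ n) (f : Fin k → Fin n)
    (Q : Ideal (R n)) [Q.IsPrime] (hD : firstMinor (Nat.le_of_succ_le hk) f ∉ Q)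
    (hQ : ∀ s ∈ pivotVars hk f a,
      firstMinor (Nat.le_of_succ_le hk) f * X s - pivotConst hk f s ∈ Q) :
    Lideal n a + Kideal n (k + 1) ≤ Q := by
  refine sup_le (Ideal.span_le.mpr ?_) (Ideal.span_le.mpr ?_)
  · rintro _ ⟨l, hl, rfl⟩
    have h := hQ (0, l) ((mem_pivotVars ..).mpr (Or.inl ⟨rfl, hl⟩))
    rw [pivotConst, if_pos rfl, sub_zero] at h
    exact (Ideal.IsPrime.mem_or_mem ‹_› h).resolve_left hD
  · rintro _ ⟨_, B, -, hB0, rfl⟩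
    have hmk {m : ℕ} (hm : m ≤ n) (g : Fin m → Fin n) : Ideal.Quotient.mk Q (firstMinor hm g) =
        (Matrix.of fun p q => Ideal.Quotient.mk Q (X (g p, Fin.castLE hm q))).det := by
      rw [firstMinor, RingHom.map_det]
      rfl
    change firstMinor hk B ∈ Q
    rw [← Ideal.Quotient.eq_zero_iff_mem, hmk]
    refine det_eq_zero_of_bordered_eq_zero
      (fun r q => Ideal.Quotient.mk Q (X (r, Fin.castLE hk q))) f ?_ B fun p => ?_
    · intro h
      refine hD (Ideal.Quotient.eq_zero_iff_mem.mp ?_)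
      rw [hmk]
      exact h
    · by_cases hp : ∃ t, f t = B p
      · obtain ⟨t, ht⟩ := hp
        refine Matrix.det_zero_of_row_eq (i := t.castSucc) (j := Fin.last k)
          (Fin.castSucc_lt_last t).ne ?_
        ext q
        simp [ht]
      · have h := hQ (B p, ⟨k, hk⟩) ((mem_pivotVars ..).mpr
          (Or.inr ⟨⟨fun h => hB0 p (by simpa using congrArg Fin.val h), not_exists.mp hp⟩, rfl⟩))
        rw [pivotConst, if_neg fun h => hB0 p (by simpa using congrArg Fin.val h),
          firstMinor_snoc, ← Ideal.Quotient.eq_zero_iff_mem, hmk] at h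
        exact h

lemma le_ringKrullDim_quotient [NeZero n] (a k : ℕ) (ha : a ≤ n) (hk : k + 1 ≤ n) :
    ((n * n - (a + (n - (k + 1))) : ℕ) : WithBot ℕ∞) ≤
      ringKrullDim (R n ⧸ (Lideal n a + Kideal n (k + 1))) := by
  classical
  let f : Fin k → Fin n := fun p => ⟨p + 1, by lia⟩
  have hf : Function.Injective f := fun p q h => by simpa [f, Fin.ext_iff] using h
  have hf0 : ∀ p, f p ≠ 0 := fun p h => by simp [f, Fin.ext_iff] at h
  let v : Fin n × Fin n → ℂ := fun s => if (s.1 : ℕ) = s.2 + 1 ∧ (s.2 : ℕ) < k then 1 else 0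
  let M : Ideal (R n) := RingHom.ker (aeval (R := ℂ) v)
  have hM : M.IsPrime := RingHom.ker_isPrime _
  have hev {m : ℕ} (hm : m ≤ n) (g : Fin m → Fin n) : aeval (R := ℂ) v (firstMinor hm g) =
      (Matrix.of fun p q => v (g p, Fin.castLE hm q)).det := by
    rw [firstMinor, AlgHom.map_det]
    congr 1
    ext
    simp
  have hDM : firstMinor (Nat.le_of_succ_le hk) f ∉ M := by
    have : (Matrix.of fun p q => v (f p, Fin.castLE (Nat.le_of_succ_le hk) q)) = 1 := by
      ext p q
      simp [v, f, Matrix.one_apply, Fin.ext_iff]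
    rw [RingHom.mem_ker, hev, this, Matrix.det_one]
    exact one_ne_zero
  let gen : Fin n × Fin n → R n := fun s =>
    firstMinor (Nat.le_of_succ_le hk) f * X s - pivotConst hk f s
  have hgenM : ∀ s ∈ pivotVars hk f a, gen s ∈ M := by
    rintro ⟨r, c⟩ hs
    rw [mem_pivotVars] at hs
    rcases hs with ⟨h0, hlt⟩ | ⟨⟨h0, hr⟩, h2⟩
    · obtain rfl : r = 0 := h0
      have : aeval (R := ℂ) v (X (0, c) : R n) = 0 := by simp [v]
      simp only [gen, pivotConst, if_pos, sub_zero]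
      exact M.mul_mem_left _ this
    · obtain rfl : c = ⟨k, hk⟩ := h2
      simp only [gen, pivotConst]
      rw [if_neg h0, firstMinor_snoc, RingHom.mem_ker, hev]
      refine Matrix.det_eq_zero_of_row_eq_zero (Fin.last k) fun q => ?_
      simp only [Matrix.of_apply, Fin.snoc_last, v, Fin.val_castLE]
      rw [if_neg]
      rintro ⟨h1, h2⟩
      exact hr ⟨q, h2⟩ (Fin.ext h1.symm)
  have hheight : ((n * n : ℕ) : ℕ∞) ≤ M.height := by
    have := card_le_height (1 : R n) (fun s => C (v s)) Finset.univ (one_mem _)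
      (fun s _ => Subalgebra.algebraMap_mem _ (v s)) M ((Ideal.ne_top_iff_one M).mp hM.ne_top)
      fun s _ => by simp [M, RingHom.mem_ker]
    simpa using this
  have hmain := sub_card_le_ringKrullDim_quotient (Lideal n a + Kideal n (k + 1)) M
    ((pivotVars hk f a).image gen) (n * n) hheight
    (by
      intro x hx
      obtain ⟨s, hs, rfl⟩ := Finset.mem_image.mp (Finset.mem_coe.mp hx)
      exact hgenM s hs)
    fun Q hQ hsQ hQM => le_of_pivot_mem a hk f Q (fun h => hDM (hQM h)) fun s hs =>
      hsQ (Finset.mem_coe.mpr (Finset.mem_image_of_mem gen hs))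
  refine le_trans ?_ hmain
  have hcard := (Finset.card_image_le (s := pivotVars hk f a) (f := gen)).trans
    (card_pivotVars hk f a hf hf0 ha).le
  norm_cast
  lia

lemma mul_self_sub_eq (n i j : ℕ) (hi : 1 ≤ i) (hij : i ≤ j) (hj : j ≤ n) :
    n * n - (i - 1 + (n - j)) = n * (n + 1) / 2 + (n - 1) * (n - 2) / 2 + (j - i) := by
  obtain _ | _ | m := n
  · lia
  · simp; lia
  · obtain ⟨u, hu⟩ := Nat.even_mul_succ_self m
    have h1 : (m + 1 + 1) * (m + 1 + 1 + 1) = 2 * (u + 2 * m + 3) := by linarith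
    have h2 : (m + 1 + 1 - 1) * (m + 1 + 1 - 2) = 2 * u := by
      simp only [Nat.add_sub_cancel, Nat.reduceSubDiff]
      linarith
    have h3 : (m + 1 + 1) * (m + 1 + 1) = 2 * u + 3 * m + 4 := by linarith
    rw [h1, h2, h3, Nat.mul_div_cancel_left _ two_pos, Nat.mul_div_cancel_left _ two_pos]
    lia

/-- for `1 ≤ i ≤ j ≤ n`, the Krull dimension of `R / (L_{i-1} + K_j)`
equals `n(n+1)/2 + (n-1)(n-2)/2 + (j - i)`. -/
theorem stmt12 (n : ℕ) [NeZero n] (i j : ℕ) (hi : 1 ≤ i) (hij : i ≤ j) (hj : j ≤ n) :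
    ringKrullDim (R n ⧸ (Lideal n (i - 1) + Kideal n j)) =
      ((n * (n + 1) / 2 + (n - 1) * (n - 2) / 2 + (j - i) : ℕ) : WithBot ℕ∞) := by
  rw [← mul_self_sub_eq n i j hi hij hj]
  refine le_antisymm ?_ ?_
  · refine ringKrullDim_quotient_le_sub _ _ _ ?_ fun P _ hP =>
      le_height_of_le (i - 1) j (by lia) hj P hP
    simp [ringKrullDim_eq_zero_of_field]
  · obtain ⟨k, rfl⟩ : ∃ k, j = k + 1 := ⟨j - 1, by lia⟩
    exact le_ringKrullDim_quotient (i - 1) k (by lia) hj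
end
end

section
/- Let h be a Hessenberg function on {1,…,n}. For all corners i, j ∈ C(h), the Krull dimensions of the quotient rings R / (L_{i−1} + K_{h(i)}) and R / (L_{j−1} + K_{h(j)}) are equal if and only if h(i) − i = h(j) − j. Consequently, all the quotients R / (L_{i−1} + K_{h(i)}) for i ∈ C(h) have the same Krull dimension if and only if h(i) − i = h(j) − j for all i, j ∈ C(h). -/
open MvPolynomial

noncomputable section

theorem ringKrullDim_eq_of_isIntegral_of_injective {A B : Type*} [CommRing A] [CommRing B]
    [Algebra A B] [Algebra.IsIntegral A B] [FaithfulSMul A B] :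
    ringKrullDim B = ringKrullDim A := by
  apply le_antisymm
  · refine Order.krullDim_le_of_strictMono (PrimeSpectrum.comap (algebraMap A B)) ?_
    intro P Q hPQ
    exact Ideal.IsIntegral.comap_lt_comap hPQ
  · refine iSup_le fun l => ?_
    obtain ⟨P, hP, hl⟩ := (inferInstance : Nonempty (l.head.asIdeal.primesOver B))
    obtain ⟨L, hL, -⟩ := Ideal.exists_ltSeries_of_hasGoingUp l P
    rw [← hL]
    exact le_iSup (fun p : LTSeries (PrimeSpectrum B) => (p.length : WithBot ℕ∞)) L

theorem exists_ringKrullDim_eq_and_trdeg_eq (k A : Type) [Field k] [CommRing A] [IsDomain A]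
    [Algebra k A] [Algebra.FiniteType k A] :
    ∃ s : ℕ, ringKrullDim A = s ∧ Algebra.trdeg k A = s := by
  obtain ⟨s, g, hg, hint⟩ := exists_integral_inj_algHom_of_fg k A
  refine ⟨s, ?_⟩
  let alg : Algebra (MvPolynomial (Fin s) k) A := g.toRingHom.toAlgebra
  have : IsScalarTower k (MvPolynomial (Fin s) k) A :=
    IsScalarTower.of_algebraMap_eq fun x => (g.commutes x).symm
  have : Algebra.IsIntegral (MvPolynomial (Fin s) k) A := ⟨hint⟩
  have : FaithfulSMul (MvPolynomial (Fin s) k) A :=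
    (faithfulSMul_iff_algebraMap_injective _ _).mpr hg
  constructor
  · rw [ringKrullDim_eq_of_isIntegral_of_injective (A := MvPolynomial (Fin s) k)]
    simp
  · rw [← trdeg_add_eq k (MvPolynomial (Fin s) k)]
    simp [trdeg_eq_zero]

theorem ringKrullDim_quotient_le_of_forall_isPrime {A : Type*} [CommRing A] {I : Ideal A}
    {d : WithBot ℕ∞} (h : ∀ P : Ideal A, P.IsPrime → I ≤ P → ringKrullDim (A ⧸ P) ≤ d) :
    ringKrullDim (A ⧸ I) ≤ d := by
  rw [ringKrullDim_quotient]
  refine iSup_le fun l => ?_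
  refine le_trans ?_ (h l.head.1.asIdeal l.head.1.2 l.head.2)
  rw [ringKrullDim_quotient]
  let L : LTSeries (PrimeSpectrum.zeroLocus (l.head.1.asIdeal : Set A)) :=
    { length := l.length
      toFun := fun i => ⟨(l i).1, l.head_le i⟩
      step := fun i => l.step i }
  exact le_iSup (fun p : LTSeries (PrimeSpectrum.zeroLocus (l.head.1.asIdeal : Set A)) =>
    (p.length : WithBot ℕ∞)) L

theorem exists_col_eq_sum_of_maximal_minors_eq_zero {F : Type} [Field F] {N m : ℕ}
    (A : Matrix (Fin N) (Fin m) F)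
    (hA : ∀ f : Fin m → Fin N, StrictMono f → (A.submatrix f id).det = 0) :
    ∃ (l₀ : Fin m) (t : {l // l ≠ l₀} → F), ∀ k, A k l₀ = ∑ l, t l * A k l := by
  have hdep : ¬ LinearIndependent F A.col := by
    intro hli
    have hrank : Module.finrank F (Submodule.span F (Set.range A.row)) = m := by
      rw [← A.rank_eq_finrank_span_row, ← A.rank_transpose]
      simpa using LinearIndependent.rank_matrix (M := A.transpose) hli
    obtain ⟨κ, a, ha, hspan, hind⟩ := exists_linearIndependent' F A.row
    have := Finite.of_injective a ha
    have := Fintype.ofFinite κ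
    classical
    have hcard : (Finset.univ.map ⟨a, ha⟩).card = m := by
      rw [← hspan, finrank_span_eq_card hind] at hrank
      simpa using hrank
    let f := (Finset.univ.map ⟨a, ha⟩).orderEmbOfFin hcard
    have hmem : ∀ i, ∃ x, a x = f i := by
      intro i
      obtain ⟨x, -, hx⟩ := Finset.mem_map.mp
        (Finset.orderEmbOfFin_mem (Finset.univ.map ⟨a, ha⟩) hcard i)
      exact ⟨x, hx⟩
    choose b hb using hmem
    have hbinj : Function.Injective b := fun i j hij =>
      f.injective (by rw [← hb, ← hb, hij])
    have hrow : LinearIndependent F (A.submatrix f id).row := by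
      convert! hind.comp b hbinj using 1
      ext i j
      exact congrFun (congrArg A (hb i).symm) j
    have := Matrix.linearIndependent_rows_iff_isUnit.mp hrow
    rw [Matrix.isUnit_iff_isUnit_det, hA f f.strictMono] at this
    simp at this
  rw [Fintype.not_linearIndependent_iff] at hdep
  obtain ⟨g, hg, l₀, hl₀⟩ := hdep
  refine ⟨l₀, fun l => -(g l / g l₀), fun k => ?_⟩
  have h := congrFun hg k
  simp only [Finset.sum_apply, Pi.smul_apply, Matrix.col_apply, smul_eq_mul, Pi.zero_apply] at h
  rw [← Fintype.sum_subtype_add_sum_subtype (fun l => l ≠ l₀)] at h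
  have h2 : ∑ l : {l // ¬ l ≠ l₀}, g l * A k l = g l₀ * A k l₀ := by
    rw [Fintype.sum_eq_single ⟨l₀, by simp⟩]
    rintro ⟨x, hx⟩ hne
    simp at hx; simp [hx] at hne
  rw [h2] at h
  apply mul_left_cancel₀ hl₀
  rw [Finset.mul_sum, ← sub_eq_zero, ← h, add_comm, sub_eq_add_neg, ← Finset.sum_neg_distrib]
  congr 1
  refine Finset.sum_congr rfl fun l _ => ?_
  field_simp

theorem natCard_le_ringKrullDim_quotient {k A F ι : Type} [Field k] [CommRing A] [Algebra k A]
    [Algebra.FiniteType k A] [CommRing F] [IsDomain F] [Algebra k F] [Finite ι] (ψ : A →ₐ[k] F)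
    {I : Ideal A} (hI : I ≤ RingHom.ker ψ) (a : ι → A) (ha : AlgebraicIndependent k (ψ ∘ a)) :
    (Nat.card ι : WithBot ℕ∞) ≤ ringKrullDim (A ⧸ I) := by
  let P := RingHom.ker ψ
  have hP : P.IsPrime := RingHom.ker_isPrime ψ
  obtain ⟨s, hdim, htr⟩ := exists_ringKrullDim_eq_and_trdeg_eq k (A ⧸ P)
  refine le_trans ?_ (ringKrullDim_le_of_surjective (Ideal.Quotient.factor hI)
    (Ideal.Quotient.factor_surjective hI))
  change _ ≤ ringKrullDim (A ⧸ P)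
  rw [hdim]
  have hind : AlgebraicIndependent k (Ideal.Quotient.mk P ∘ a) :=
    AlgebraicIndependent.of_comp (Ideal.kerLiftAlg ψ) ha
  have h := hind.cardinalMk_le_trdeg
  rw [htr, ← Nat.cast_card] at h
  exact_mod_cast h

/-- The number of entries of the first row past column `i`, plus the dimension of the variety of
`N × (M + 1)` matrices with linearly dependent columns, plus the number of entries outside. -/
def expectedDim (N M i : ℕ) : ℕ := (N + 1 - i) + (N * N + M)

theorem card_subtype_le_val {n i : ℕ} (hi : i < n) :
    Fintype.card {l : Fin n // i ≤ (l : ℕ)} = n - i := by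
  rw [Fintype.card_subtype, ← Fin.card_Ici ⟨i, hi⟩]
  congr 1
  ext l
  simp [Fin.le_def]

theorem ringKrullDim_quotient_le_of_isPrime (N M i : ℕ) (hM : M + 1 ≤ N + 1) (P : Ideal (R (N + 1)))
    [hP : P.IsPrime] (hle : Lideal (N + 1) i + Kideal (N + 1) (M + 1) ≤ P) (hi : i < N + 1) :
    ringKrullDim (R (N + 1) ⧸ P) ≤ expectedDim N M i := by
  obtain ⟨s, hdim, htr⟩ := exists_ringKrullDim_eq_and_trdeg_eq ℂ (R (N + 1) ⧸ P)
  let F := FractionRing (R (N + 1) ⧸ P)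
  let φ : (R (N + 1) ⧸ P) →ₐ[ℂ] F := IsScalarTower.toAlgHom ℂ _ F
  have hφ : Function.Injective φ := IsFractionRing.injective (R (N + 1) ⧸ P) F
  let ψ : R (N + 1) →ₐ[ℂ] F := φ.comp (Ideal.Quotient.mkₐ ℂ P)
  have hψ : ∀ p ∈ P, ψ p = 0 := fun p hp => by
    simp [ψ, Ideal.Quotient.eq_zero_iff_mem.mpr hp]
  have hL : ∀ l : Fin (N + 1), (l : ℕ) < i → ψ (X (0, l)) = 0 := fun l hl =>
    hψ _ (hle (Ideal.mem_sup_left (Ideal.subset_span ⟨l, hl, rfl⟩)))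
  obtain ⟨l₀, t, ht⟩ := exists_col_eq_sum_of_maximal_minors_eq_zero
    (Matrix.of fun (k : Fin N) (l : Fin (M + 1)) => ψ (X (k.succ, Fin.castLE hM l))) (by
      intro f hf
      rw [← hψ _ (hle (Ideal.mem_sup_right (Ideal.subset_span ⟨hM, fun k => (f k).succ,
        fun a b hab => Fin.succ_lt_succ_iff.mpr (hf hab), fun k => by simp, rfl⟩))),
        AlgHom.map_det]
      rfl)
  let ι := {l : Fin (N + 1) // i ≤ (l : ℕ)} ⊕
    (Fin N × {l : Fin (N + 1) // l ≠ Fin.castLE hM l₀} ⊕ {l : Fin (M + 1) // l ≠ l₀})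
  let y : ι → F := Sum.elim (fun l => ψ (X (0, l.1)))
    (Sum.elim (fun p => ψ (X (p.1.succ, p.2.1))) t)
  let B := (aeval y : MvPolynomial ι ℂ →ₐ[ℂ] F).range
  have hy : ∀ j, y j ∈ B := fun j => ⟨X j, by simp⟩
  have hB : ∀ p, ψ p ∈ B := by
    have hne : ∀ (k : Fin N) (l : Fin (N + 1)), l ≠ Fin.castLE hM l₀ → ψ (X (k.succ, l)) ∈ B :=
      fun k l hl => hy (.inr (.inl (k, ⟨l, hl⟩)))
    have hX : ∀ q : Fin (N + 1) × Fin (N + 1), ψ (X q) ∈ B := by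
      rintro ⟨k, l⟩
      cases k using Fin.cases with
      | zero =>
        by_cases hl : (l : ℕ) < i
        · rw [hL l hl]; exact B.zero_mem
        · exact hy (.inl ⟨l, not_lt.mp hl⟩)
      | succ k =>
        by_cases hl : l = Fin.castLE hM l₀
        · rw [hl, show ψ (X (k.succ, Fin.castLE hM l₀)) = _ from ht k]
          exact B.sum_mem fun l _ => B.mul_mem (hy (.inr (.inr l)))
            (hne k _ fun h => l.2 (Fin.castLE_injective hM h))
        · exact hne k l hl
    intro p
    induction p using MvPolynomial.induction_on with
    | C a => exact (ψ.commutes a).symm ▸ B.algebraMap_mem a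
    | add p q hp hq => rw [map_add]; exact B.add_mem hp hq
    | mul_X p q hp => rw [map_mul]; exact B.mul_mem hp (hX q)
  let χ : (R (N + 1) ⧸ P) →ₐ[ℂ] B := φ.codRestrict B fun z => by
    obtain ⟨p, rfl⟩ := Ideal.Quotient.mk_surjective z
    exact hB p
  have h1 : Algebra.trdeg ℂ (R (N + 1) ⧸ P) ≤ Algebra.trdeg ℂ B :=
    trdeg_le_of_injective χ (AlgHom.injective_codRestrict φ B _ |>.mpr hφ)
  have h2 : Algebra.trdeg ℂ B ≤ Algebra.trdeg ℂ (MvPolynomial ι ℂ) :=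
    trdeg_le_of_surjective _ (AlgHom.rangeRestrict_surjective (aeval y))
  have hcard : Nat.card ι = expectedDim N M i := by
    simp [ι, expectedDim, card_subtype_le_val hi]
  rw [hdim]
  have h3 := h1.trans h2
  rw [htr, MvPolynomial.trdeg_of_isDomain, Cardinal.lift_id, ← Nat.cast_card, hcard] at h3
  exact_mod_cast h3

theorem le_ringKrullDim_quotient_s13 (N M i : ℕ) (hM : M + 1 ≤ N + 1) (hi : i < N + 1) :
    (expectedDim N M i : WithBot ℕ∞) ≤
      ringKrullDim (R (N + 1) ⧸ (Lideal (N + 1) i + Kideal (N + 1) (M + 1))) := by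
  let F := FractionRing (R (N + 1))
  let x : Fin (N + 1) → Fin (N + 1) → F := fun k l => algebraMap (R (N + 1)) F (X (k, l))
  let c : Fin (N + 1) := ⟨M, hM⟩
  let ρ : Fin M → Fin (N + 1) := fun k => ⟨k + 1, by omega⟩
  let γ : Fin M → Fin (N + 1) := fun l => ⟨l, by omega⟩
  have hρ : Function.Injective ρ := fun a b h => by simpa [ρ, Fin.ext_iff] using h
  have hρ0 : ∀ k, ρ k ≠ 0 := fun k => by simp [ρ, Fin.ext_iff]
  have hγ : Function.Injective γ := fun a b h => by simpa [γ, Fin.ext_iff] using h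
  obtain ⟨t, ht⟩ : ∃ t : Fin M → F, ∀ k, ∑ l, x (ρ k) (γ l) * t l = x (ρ k) c := by
    let A : Matrix (Fin M) (Fin M) F := Matrix.of fun k l => x (ρ k) (γ l)
    have hA : A.det ≠ 0 := by
      have : A.det = algebraMap (R (N + 1)) F (rename (Prod.map ρ γ)
          (Matrix.mvPolynomialX (Fin M) (Fin M) ℂ).det) := by
        rw [AlgHom.map_det, RingHom.map_det]
        congr 1
        ext k l
        simp [A, x]
      rw [this]
      refine (map_ne_zero_iff _ (IsFractionRing.injective (R (N + 1)) F)).mpr ?_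
      exact (map_ne_zero_iff _ (rename_injective _ (hρ.prodMap hγ))).mpr
        (Matrix.det_mvPolynomialX_ne_zero (Fin M) ℂ)
    refine ⟨A⁻¹.mulVec fun k => x (ρ k) c, fun k => ?_⟩
    have : A.mulVec (A⁻¹.mulVec fun k => x (ρ k) c) = fun k => x (ρ k) c := by
      rw [Matrix.mulVec_mulVec, Matrix.mul_nonsing_inv _ hA.isUnit, Matrix.one_mulVec]
    exact congrFun this k
  let y : Fin (N + 1) × Fin (N + 1) → F := fun p =>
    if p.1 = 0 then (if (p.2 : ℕ) < i then 0 else x 0 p.2)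
    else if p.2 = c then ∑ l, x p.1 (γ l) * t l else x p.1 p.2
  have hcγ : ∀ l, γ l ≠ c := fun l h => by simp [γ, c] at h; omega
  let ψ : R (N + 1) →ₐ[ℂ] F := aeval y
  let ι := {l : Fin (N + 1) // i ≤ (l : ℕ)} ⊕ (Fin N × {l : Fin (N + 1) // l ≠ c} ⊕ Fin M)
  let e : ι → Fin (N + 1) × Fin (N + 1) := Sum.elim (fun l => (0, l.1))
    (Sum.elim (fun p => (p.1.succ, p.2.1)) fun k => (ρ k, c))
  have he : Function.Injective e := by
    refine Function.Injective.sumElim (fun a b h => Subtype.ext (congrArg Prod.snd h))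
      (Function.Injective.sumElim (fun a b h => ?_) (fun a b h => hρ (congrArg Prod.fst h))
        fun a b h => a.2.2 (congrArg Prod.snd h)) ?_
    · exact Prod.ext (Fin.succ_injective _ (congrArg Prod.fst h))
        (Subtype.ext (congrArg Prod.snd h))
    · rintro a (b | b) h
      · exact Fin.succ_ne_zero b.1 (congrArg Prod.fst h).symm
      · exact hρ0 b (congrArg Prod.fst h).symm
  have hye : ∀ j, ψ (X (e j)) = algebraMap (R (N + 1)) F (X (e j)) := by
    rintro (⟨l, hl⟩ | ⟨k, l, hl⟩ | k)
    · simp [ψ, y, e, not_lt.mpr hl, x]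
    · simp [ψ, y, e, hl, x]
    · simp [ψ, y, e, hρ0, ht, x]
  have hcard : Nat.card ι = expectedDim N M i := by
    simp [ι, expectedDim, card_subtype_le_val hi]
  rw [← hcard]
  refine natCard_le_ringKrullDim_quotient ψ (sup_le ?_ ?_) (fun j => X (e j)) ?_
  · refine Ideal.span_le.mpr ?_
    rintro _ ⟨l, hl, rfl⟩
    simp [ψ, y, hl]
  · refine Ideal.span_le.mpr ?_
    rintro _ ⟨hj, b, -, hb, rfl⟩
    change ψ _ = 0
    rw [AlgHom.map_det]
    refine Matrix.exists_mulVec_eq_zero_iff.mp ⟨Fin.snoc t (-1), fun h => ?_, ?_⟩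
    · simpa using congrFun h (Fin.last M)
    · ext k
      have hk : b k ≠ 0 := fun h => hb k (by simp [h])
      have h1 : ∀ l : Fin M, Fin.castLE hj l.castSucc = γ l := fun l => rfl
      have h2 : Fin.castLE hj (Fin.last M) = c := rfl
      simp [Matrix.mulVec, dotProduct, Fin.sum_univ_castSucc, h1, h2, ψ, y, hk, hcγ]
      ring
  · have : (⇑ψ ∘ fun j => X (e j)) = fun j => algebraMap (R (N + 1)) F (X (e j)) := funext hye
    rw [this]
    have hX : AlgebraicIndependent ℂ (X : Fin (N + 1) × Fin (N + 1) → R (N + 1)) :=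
      MvPolynomial.algebraicIndependent_X _ _
    exact (hX.comp e he).map' (f := IsScalarTower.toAlgHom ℂ (R (N + 1)) F)
      (IsFractionRing.injective (R (N + 1)) F)

theorem ringKrullDim_quotient_Lideal_add_Kideal (N M i : ℕ) (hM : M + 1 ≤ N + 1)
    (hi : i < N + 1) :
    ringKrullDim (R (N + 1) ⧸ (Lideal (N + 1) i + Kideal (N + 1) (M + 1))) =
      expectedDim N M i :=
  le_antisymm (ringKrullDim_quotient_le_of_forall_isPrime fun P _ hle =>
    ringKrullDim_quotient_le_of_isPrime N M i hM P hle hi) (le_ringKrullDim_quotient_s13 N M i hM hi)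

/-- Corollary 4.5: for corners `i, j ∈ C(h)`, the Krull dimensions of
`R / (L_{i-1} + K_{h(i)})` and `R / (L_{j-1} + K_{h(j)})` agree iff `h(i) - i = h(j) - j`;
consequently all these quotients have the same Krull dimension iff `h(i) - i = h(j) - j`
for all corners `i, j`. (0-based: the paper's corner `i` is `i+1`, so `L_{i-1}` is
`Lideal n i`, `K_{h(i)}` is `Kideal n ((h i) + 1)`, and `h(i) - i = (h i) - i` 0-based.) -/
theorem stmt13 (n : ℕ) [NeZero n] (h : Fin n → Fin n) (hh : IsHessenberg n h) :
    (∀ i j : Fin n, HessCorner n h i → HessCorner n h j →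
      (ringKrullDim (R n ⧸ (Lideal n (i : ℕ) + Kideal n (((h i) : ℕ) + 1))) =
        ringKrullDim (R n ⧸ (Lideal n (j : ℕ) + Kideal n (((h j) : ℕ) + 1))) ↔
        ((h i) : ℕ) - (i : ℕ) = ((h j) : ℕ) - (j : ℕ))) ∧
    ((∀ i j : Fin n, HessCorner n h i → HessCorner n h j →
        ringKrullDim (R n ⧸ (Lideal n (i : ℕ) + Kideal n (((h i) : ℕ) + 1))) =
          ringKrullDim (R n ⧸ (Lideal n (j : ℕ) + Kideal n (((h j) : ℕ) + 1)))) ↔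
      (∀ i j : Fin n, HessCorner n h i → HessCorner n h j →
        ((h i) : ℕ) - (i : ℕ) = ((h j) : ℕ) - (j : ℕ))) := by
  suffices H : ∀ i j : Fin n, HessCorner n h i → HessCorner n h j →
      (ringKrullDim (R n ⧸ (Lideal n (i : ℕ) + Kideal n (((h i) : ℕ) + 1))) =
        ringKrullDim (R n ⧸ (Lideal n (j : ℕ) + Kideal n (((h j) : ℕ) + 1))) ↔
        ((h i) : ℕ) - (i : ℕ) = ((h j) : ℕ) - (j : ℕ)) from
    ⟨H, forall₄_congr H⟩
  intro i j _ _
  obtain _ | N := n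
  · exact i.elim0
  have hi : (i : ℕ) ≤ h i := hh.2 i
  have hj : (j : ℕ) ≤ h j := hh.2 j
  rw [ringKrullDim_quotient_Lideal_add_Kideal N _ _ (h i).isLt i.isLt,
    ringKrullDim_quotient_Lideal_add_Kideal N _ _ (h j).isLt j.isLt]
  norm_cast
  unfold expectedDim
  omega
end
end

section
/- For every i ∈ {1, …, n−1}, the ideal L_i equals the Schubert determinantal ideal I_{u[i+1]} of the permutation u[i+1]. -/
open MvPolynomial

noncomputable section

/-- A determinant with one row in an ideal lies in that ideal. -/
theorem det_mem_of_row_mem {m : Type*} [Fintype m] [DecidableEq m] {A : Type*} [CommRing A]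
    (I : Ideal A) (M : Matrix m m A) (k : m) (hk : ∀ l, M k l ∈ I) : M.det ∈ I := by
  rw [← Matrix.det_transpose, Matrix.det_apply']
  refine I.sum_mem fun σ _ => I.mul_mem_left _ ?_
  exact I.mem_of_dvd (Finset.dvd_prod_of_mem _ (Finset.mem_univ k)) (hk (σ k))

/-- An injective row or column selection from the first `p + 1` indices has size at most `p + 1`. -/
theorem le_of_injective_of_forall_le {n r : ℕ} {p : Fin n} {f : Fin (r + 1) → Fin n}
    (hf : Function.Injective f) (hp : ∀ k, f k ≤ p) : r ≤ p := by
  have h := Finset.card_le_card_of_injOn (s := Finset.univ) (t := Finset.Iic p) f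
    (by simpa using hp) hf.injOn
  simp at h
  omega

/-- An injective selection from the first `p + 1` indices that avoids `0` has size at most `p`. -/
theorem lt_of_injective_of_forall_le_of_ne_zero {n r : ℕ} [NeZero n] {p : Fin n}
    {f : Fin (r + 1) → Fin n} (hf : Function.Injective f) (hp : ∀ k, f k ≤ p)
    (h0 : ∀ k, f k ≠ 0) : r < p := by
  have h := Finset.card_le_card_of_injOn (s := Finset.univ) (t := Finset.Ioc 0 p) f
    (fun k _ => by simpa using ⟨Fin.pos_iff_ne_zero.mpr (h0 k), hp k⟩) hf.injOn
  simp at h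
  omega

/-- If `w` fixes every index beyond `q`, the rank `r_{pq}(w)` is at least `min p q + 1`. -/
theorem lt_rankpq_of_forall_lt_fixed {n : ℕ} {w : Equiv.Perm (Fin n)} {p q : Fin n}
    (hw : ∀ j, q < j → w j = j) : ((min p q : Fin n) : ℕ) < rankpq n w p q := by
  have h : ((Finset.Iic (min p q)).map w.symm.toEmbedding).card ≤ rankpq n w p q := by
    refine Finset.card_le_card fun j hj => ?_
    simp only [Finset.mem_map_equiv, Equiv.symm_symm, Finset.mem_Iic, le_min_iff] at hj
    simp only [Finset.mem_filter, Finset.mem_univ, true_and]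
    refine ⟨not_lt.mp fun hq => ?_, hj.1⟩
    rw [hw j hq] at hj
    exact absurd hq (not_lt.mpr hj.2)
  simp only [Finset.card_map, Fin.card_Iic] at h
  omega

/-- If `w` shifts the first `q + 1` indices by one, the rank `r_{pq}(w)` is at least
`min p (q + 1)`. -/
theorem min_le_rankpq_of_shift {n : ℕ} {w : Equiv.Perm (Fin n)} {p q : Fin n}
    (hw : ∀ j, j ≤ q → ((w j : Fin n) : ℕ) = j + 1) :
    min (p : ℕ) (q + 1) ≤ rankpq n w p q := by
  rcases le_or_gt p q with hpq | hpq
  · have h : (Finset.Iio p).card ≤ rankpq n w p q := by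
      refine Finset.card_le_card fun j hj => ?_
      rw [Finset.mem_Iio] at hj
      have hjq : j ≤ q := hj.le.trans hpq
      have := hw j hjq
      simp only [Finset.mem_filter, Finset.mem_univ, true_and, Fin.le_def, Fin.lt_def] at *
      omega
    rw [Fin.card_Iio] at h
    omega
  · have h : (Finset.Iic q).card ≤ rankpq n w p q := by
      refine Finset.card_le_card fun j hj => ?_
      rw [Finset.mem_Iic] at hj
      have := hw j hj
      simp only [Finset.mem_filter, Finset.mem_univ, true_and, Fin.le_def, Fin.lt_def] at *
      omega
    rw [Fin.card_Iic] at h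
    omega

/-- Lemma 2.2, first part: for `1 ≤ i ≤ n-1`, `L_i` is the Schubert
determinantal ideal of `u[i+1]`, the shortest permutation sending `i+1 ↦ 1` (0-based:
`u` sends position `i` to `0`, positions `j < i` to `j+1`, and fixes positions `j > i`). -/
theorem stmt14 (n : ℕ) [NeZero n] (i : ℕ) (hi1 : 1 ≤ i) (hi2 : i ≤ n - 1)
    (u : Equiv.Perm (Fin n))
    (hu : ∀ j : Fin n, ((j : ℕ) < i → ((u j) : ℕ) = (j : ℕ) + 1) ∧
      ((j : ℕ) = i → ((u j) : ℕ) = 0) ∧ ((j : ℕ) > i → u j = j)) :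
    Lideal n i = schubertIdeal n u := by
  apply le_antisymm
  · refine Ideal.span_le.mpr ?_
    rintro _ ⟨j, hj, rfl⟩
    have hr : rankpq n u 0 j = 0 := by
      rw [rankpq, Finset.card_eq_zero, Finset.filter_eq_empty_iff]
      rintro k - ⟨hkj, hk⟩
      have h := (hu k).1 (lt_of_le_of_lt hkj hj)
      simp only [Fin.le_def, Fin.val_zero] at hk
      omega
    refine Ideal.subset_span ⟨0, j, fun _ => 0, fun _ => j, fun _ => le_rfl, fun _ => le_rfl, ?_⟩
    rw [hr]
    simp
  · refine Ideal.span_le.mpr ?_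
    rintro _ ⟨p, q, f, g, hf, hg, rfl⟩
    by_cases hfi : Function.Injective f
    swap
    · obtain ⟨a, b, hab, hne⟩ := Function.not_injective_iff.mp hfi
      rw [Matrix.det_zero_of_row_eq hne (by ext l : 1; simp [hab])]
      exact zero_mem _
    by_cases hgi : Function.Injective g
    swap
    · obtain ⟨a, b, hab, hne⟩ := Function.not_injective_iff.mp hgi
      rw [Matrix.det_zero_of_column_eq hne (fun l => by simp [hab])]
      exact zero_mem _
    have hrp := le_of_injective_of_forall_le hfi hf
    have hrq := le_of_injective_of_forall_le hgi hg
    rcases le_or_gt i q with hq | hq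
    · have h := lt_rankpq_of_forall_lt_fixed (w := u) (p := p) (q := q)
        fun j hj => (hu j).2.2 (lt_of_le_of_lt hq hj)
      rcases min_choice p q with hm | hm <;> rw [hm] at h <;> omega
    · have h := min_le_rankpq_of_shift (w := u) (p := p) (q := q)
        fun j hj => (hu j).1 (lt_of_le_of_lt hj hq)
      obtain ⟨k, hk⟩ : ∃ k, f k = 0 := by
        by_contra! h0
        have := lt_of_injective_of_forall_le_of_ne_zero hfi hf h0
        omega
      refine det_mem_of_row_mem _ _ k fun l => Ideal.subset_span ⟨g l, ?_, by simp [hk]⟩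
      exact lt_of_le_of_lt (hg l) hq
end
end

section
/- For all integers i, j with 0 ≤ i ≤ n−1, 1 ≤ j ≤ n and i < j, the determinant det(Z) of the generic matrix Z does not belong to the ideal L_i + K_j. -/
open MvPolynomial

noncomputable section

/-- Evaluating the determinant of the generic matrix at `M` gives `det M`. -/
lemma eval_det_genZ (n : ℕ) (M : Matrix (Fin n) (Fin n) ℂ) :
    eval (fun p => M p.1 p.2) (genZ n).det = M.det := by
  rw [RingHom.map_det]
  congr 1
  ext k l
  simp [genZ]

/-- If the first `i` entries of the first row of `M` vanish, then so does `L_i` at `M`. -/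
lemma Lideal_le_ker_eval (n : ℕ) [NeZero n] (i : ℕ) (M : Matrix (Fin n) (Fin n) ℂ)
    (hM : ∀ l : Fin n, (l : ℕ) < i → M 0 l = 0) :
    Lideal n i ≤ RingHom.ker (eval fun p : Fin n × Fin n => M p.1 p.2) := by
  refine Ideal.span_le.mpr ?_
  rintro _ ⟨l, hl, rfl⟩
  simpa [RingHom.mem_ker] using hM l hl

/-- If one of the first `j` columns of `M` vanishes outside the first row, then `K_j` vanishes
at `M`. -/
lemma Kideal_le_ker_eval (n j : ℕ) (M : Matrix (Fin n) (Fin n) ℂ) (l : Fin n) (hl : (l : ℕ) < j)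
    (hM : ∀ k : Fin n, (k : ℕ) ≠ 0 → M k l = 0) :
    Kideal n j ≤ RingHom.ker (eval fun p : Fin n × Fin n => M p.1 p.2) := by
  refine Ideal.span_le.mpr ?_
  rintro _ ⟨hj, B, -, hB, rfl⟩
  rw [SetLike.mem_coe, RingHom.mem_ker, RingHom.map_det]
  refine Matrix.det_eq_zero_of_column_eq_zero ⟨l, hl⟩ fun k => ?_
  simpa using hM (B k) (hB k)

/-- from the proof of Theorem 4.1: for `0 ≤ i ≤ n-1`, `1 ≤ j ≤ n` with
`i < j`, the determinant of the generic matrix `Z` does not belong to `L_i + K_j`. -/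
theorem stmt16 (n : ℕ) [NeZero n] (i j : ℕ) (hi : i ≤ n - 1) (hj1 : 1 ≤ j) (hj2 : j ≤ n)
    (hij : i < j) :
    (genZ n).det ∉ Lideal n i + Kideal n j := by
  let c : Fin n := ⟨j - 1, by omega⟩
  let M : Matrix (Fin n) (Fin n) ℂ := (Equiv.swap 0 c).permMatrix ℂ
  have hL : Lideal n i ≤ RingHom.ker (eval fun p : Fin n × Fin n => M p.1 p.2) := by
    refine Lideal_le_ker_eval n i M fun l hl => ?_
    have hcl : c ≠ l := fun h => by
      have : j - 1 = (l : ℕ) := congrArg Fin.val h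
      omega
    simp [M, PEquiv.toMatrix_apply, hcl]
  have hK : Kideal n j ≤ RingHom.ker (eval fun p : Fin n × Fin n => M p.1 p.2) := by
    refine Kideal_le_ker_eval n j M c (by simp only [c]; omega) fun k hk => ?_
    have hkc : Equiv.swap 0 c k ≠ c := fun h => by
      rw [Equiv.swap_apply_eq_iff, Equiv.swap_apply_right] at h
      exact hk (by simp [h])
    simp [M, PEquiv.toMatrix_apply, hkc]
  intro hmem
  have hdet : M.det = 0 := by
    rw [← eval_det_genZ]
    exact RingHom.mem_ker.mp (sup_le hL hK hmem)
  rw [Matrix.det_permutation] at hdet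
  rcases Int.units_eq_one_or (Equiv.Perm.sign (Equiv.swap 0 c)) with h | h <;> simp [h] at hdet
end
end

section
/- Let h be a Hessenberg function on {1,…,n}, let g be an invertible n×n complex matrix, and let x, x' be n×n complex matrices with x = g x' g⁻¹. Let ψ be the ℂ-algebra automorphism of R determined by ψ(z_{ij}) = Σ_{k=1}^{n} g_{ik} z_{kj}. Then the image ideal ψ(I_{x,h})·R (the ideal generated by ψ applied to I_{x,h}) equals I_{x',h}. -/
open MvPolynomial

noncomputable section

/-- The ideal generated by the `k × k` minors of a matrix. -/
def minorIdeal {m p S : Type*} [CommRing S] (k : ℕ) (M : Matrix m p S) : Ideal S :=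
  Ideal.span { d | ∃ (f : Fin k → m) (g : Fin k → p), d = (M.submatrix f g).det }

lemma minorIdeal_mul_le {l m p S : Type*} [CommRing S] [Fintype m] (k : ℕ)
    (A : Matrix l m S) (M : Matrix m p S) : minorIdeal k (A * M) ≤ minorIdeal k M := by
  classical
  refine Ideal.span_le.2 ?_
  rintro _ ⟨f, g, rfl⟩
  have hrow : (A * M).submatrix f g =
      fun i => ∑ r : m, A (f i) r • fun j => M r (g j) := by
    ext i j
    simp [Matrix.mul_apply]
  have hdet : ((A * M).submatrix f g).det =
      ∑ r : Fin k → m, (∏ i, A (f i) (r i)) * (M.submatrix r g).det := by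
    rw [hrow]
    refine (Matrix.detRowAlternating.toMultilinearMap.map_sum
      (fun i r => A (f i) r • fun j => M r (g j))).trans ?_
    refine Finset.sum_congr rfl fun r _ => ?_
    exact Matrix.detRowAlternating.toMultilinearMap.map_smul_univ
      (fun i => A (f i) (r i)) (fun i j => M (r i) (g j))
  rw [SetLike.mem_coe, hdet]
  exact Ideal.sum_mem _ fun r _ => Ideal.mul_mem_left _ _ (Ideal.subset_span ⟨r, g, rfl⟩)

lemma minorIdeal_mul_eq_of_isUnit_det {m p S : Type*} [CommRing S] [Fintype m] [DecidableEq m]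
    (k : ℕ) (A : Matrix m m S) (hA : IsUnit A.det) (M : Matrix m p S) :
    minorIdeal k (A * M) = minorIdeal k M := by
  refine le_antisymm (minorIdeal_mul_le k A M) ?_
  conv_lhs => rw [← Matrix.nonsing_inv_mul_cancel_left A M hA]
  exact minorIdeal_mul_le k A⁻¹ (A * M)

lemma map_minorIdeal {m p S T F : Type*} [CommRing S] [CommRing T] [FunLike F S T]
    [RingHomClass F S T] (φ : F) (k : ℕ) (M : Matrix m p S) : (minorIdeal k M).map φ = minorIdeal k (M.map φ) := by
  rw [minorIdeal, minorIdeal, Ideal.map_span]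
  congr 1
  ext d
  constructor
  · rintro ⟨_, ⟨f, g, rfl⟩, rfl⟩
    exact ⟨f, g, (φ : S →+* T).map_det _⟩
  · rintro ⟨f, g, rfl⟩
    exact ⟨_, ⟨f, g, rfl⟩, (φ : S →+* T).map_det _⟩

lemma hessIdealAt_eq (n : ℕ) (x : Matrix (Fin n) (Fin n) ℂ) (h : Fin n → Fin n) (a : Fin n) :
    hessIdealAt n x h a = minorIdeal ((h a : ℕ) + 2) (hessMat n x h a) := rfl

lemma hessMat_map_aeval (n : ℕ) (h : Fin n → Fin n) (g x x' : Matrix (Fin n) (Fin n) ℂ)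
    (hx : x * g = g * x') (a : Fin n) :
    (hessMat n x h a).map
        (MvPolynomial.aeval
          (fun q : Fin n × Fin n => ∑ k : Fin n, MvPolynomial.C (g q.1 k) * X (k, q.2)) :
          R n →ₐ[ℂ] R n) =
      g.map (MvPolynomial.C : ℂ →+* R n) * hessMat n x' h a := by
  ext1 r c
  rcases c with c | c
  · have key (s : Fin n) : ∑ k, x r k * g k s = ∑ k, g r k * x' k s := by
      simpa [Matrix.mul_apply] using congrFun (congrFun hx r) s
    simp only [hessMat, Matrix.map_apply, Matrix.of_apply, Sum.elim_inl, Matrix.mul_apply, map_sum,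
      map_mul, MvPolynomial.aeval_X, MvPolynomial.algHom_C, MvPolynomial.algebraMap_eq,
      Finset.mul_sum, ← mul_assoc]
    conv_lhs => rw [Finset.sum_comm]
    conv_rhs => rw [Finset.sum_comm]
    refine Finset.sum_congr rfl fun s _ => ?_
    simp only [← map_mul, ← Finset.sum_mul, ← map_sum, key]
  · simp [hessMat, Matrix.mul_apply]

/-- Remark 3.5: if `x = g x' g⁻¹` with `g` invertible, then the image of
`I_{x,h}` under the automorphism `ψ` of `R` with `ψ(z_{ij}) = Σ_k g_{ik} z_{kj}` equals
`I_{x',h}`. -/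
theorem stmt18 (n : ℕ) [NeZero n] (h : Fin n → Fin n) (hh : IsHessenberg n h)
    (g x x' : Matrix (Fin n) (Fin n) ℂ) (hg : IsUnit g.det) (hx : x = g * x' * g⁻¹) :
    Ideal.map
        (MvPolynomial.aeval
          (fun q : Fin n × Fin n => ∑ k : Fin n, MvPolynomial.C (g q.1 k) * X (k, q.2)) :
          R n →ₐ[ℂ] R n)
        (hessIdeal n x h) =
      hessIdeal n x' h := by
  have hxg : x * g = g * x' := by
    rw [hx, Matrix.nonsing_inv_mul_cancel_right _ _ hg]
  have hC : IsUnit (g.map (MvPolynomial.C : ℂ →+* R n)).det := by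
    rw [← RingHom.mapMatrix_apply, ← RingHom.map_det]
    exact hg.map _
  simp only [hessIdeal, Ideal.sum_eq_sup, Finset.sup_eq_iSup, Ideal.map_iSup, hessIdealAt_eq,
    map_minorIdeal, hessMat_map_aeval n h g x x' hxg, minorIdeal_mul_eq_of_isUnit_det _ _ hC]
end
end
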